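/- Let ε > 0, let w ∈ ℂ^N, let J be an n×N complex matrix, set F = J H(w) J^*, and let Φ, Ψ be n×n complex matrices satisfying ‖J‖₂² · ‖Ψ‖₂² < ε, where ‖·‖₂ is the operator (spectral) norm. Then for every nonzero x ∈ ℂ^n one has (1+‖w‖²)^{-2} · x^*(Φ F Φ^* − Ψ Fᵀ Ψ^*) x + ε‖x‖² > 0. -/

import Mathlib

open Matrix ComplexOrder

/-- The squared Euclidean norm `‖v‖²` of a vector `v ∈ ℂ^k`. -/
noncomputable def sqNorm {k : ℕ} (v : Fin k → ℂ) : ℝ := ∑ i, ‖v i‖ ^ 2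

/-- The matrix `H(w) = (1 + ‖w‖²) I_N − w̄ wᵀ`, with `(l,m)` entry
`(1+‖w‖²)δ_{lm} − w̄_l w_m`. -/
noncomputable def Hmat {N : ℕ} (w : Fin N → ℂ) : Matrix (Fin N) (Fin N) ℂ :=
  ((1 + sqNorm w : ℝ) : ℂ) • (1 : Matrix (Fin N) (Fin N) ℂ) -
    Matrix.vecMulVec (star w) w

/-- The operator (spectral) norm `‖A‖₂` of a complex matrix `A`, i.e. the
operator norm of the induced linear map between Euclidean spaces. -/
noncomputable def opNorm {m k : ℕ} (A : Matrix (Fin m) (Fin k) ℂ) : ℝ :=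
  ‖LinearMap.toContinuousLinearMap (Matrix.toEuclideanLin A)‖

/-- `sqNorm` is the squared norm of the corresponding vector of Euclidean space. -/
theorem sqNorm_eq_norm_sq {k : ℕ} (v : Fin k → ℂ) : sqNorm v = ‖WithLp.toLp 2 v‖ ^ 2 := by
  simp [sqNorm, EuclideanSpace.norm_sq_eq]

theorem sqNorm_nonneg {k : ℕ} (v : Fin k → ℂ) : 0 ≤ sqNorm v :=
  Finset.sum_nonneg fun _ _ => sq_nonneg _

theorem sqNorm_pos {k : ℕ} {v : Fin k → ℂ} (hv : v ≠ 0) : 0 < sqNorm v := by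
  rw [sqNorm_eq_norm_sq]
  have : WithLp.toLp 2 v ≠ 0 := by simpa using hv
  positivity

theorem sqNorm_star {k : ℕ} (v : Fin k → ℂ) : sqNorm (star v) = sqNorm v := by
  simp [sqNorm]

theorem star_dotProduct_self_eq_sqNorm {k : ℕ} (v : Fin k → ℂ) :
    star v ⬝ᵥ v = (sqNorm v : ℂ) := by
  simp [sqNorm, dotProduct, Complex.conj_mul']

/-- The Cauchy–Schwarz inequality for the bilinear dot product. -/
theorem norm_dotProduct_sq_le {k : ℕ} (v u : Fin k → ℂ) :
    ‖v ⬝ᵥ u‖ ^ 2 ≤ sqNorm v * sqNorm u := by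
  have h : ‖v ⬝ᵥ u‖ ≤ ∑ i, ‖v i‖ * ‖u i‖ :=
    (norm_sum_le _ _).trans_eq (Finset.sum_congr rfl fun i _ => norm_mul _ _)
  exact (pow_le_pow_left₀ (norm_nonneg _) h 2).trans (Finset.sum_mul_sq_le_sq_mul_sq _ _ _)

open scoped Matrix.Norms.L2Operator in
theorem sqNorm_conjTranspose_mulVec_le {m k : ℕ} (A : Matrix (Fin m) (Fin k) ℂ)
    (x : Fin m → ℂ) : sqNorm (Aᴴ *ᵥ x) ≤ opNorm A ^ 2 * sqNorm x := by
  have hA : opNorm A = ‖Aᴴ‖ := (l2_opNorm_conjTranspose A).symm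
  rw [hA, sqNorm_eq_norm_sq, sqNorm_eq_norm_sq, ← mul_pow]
  exact pow_le_pow_left₀ (norm_nonneg _) (l2_opNorm_mulVec Aᴴ (WithLp.toLp 2 x)) 2

theorem star_dotProduct_mul_mul_conjTranspose_mulVec {m k : ℕ} (B : Matrix (Fin m) (Fin k) ℂ)
    (M : Matrix (Fin k) (Fin k) ℂ) (x : Fin m → ℂ) :
    star x ⬝ᵥ ((B * M * Bᴴ) *ᵥ x) = star (Bᴴ *ᵥ x) ⬝ᵥ (M *ᵥ (Bᴴ *ᵥ x)) := by
  rw [star_mulVec, conjTranspose_conjTranspose, ← dotProduct_mulVec, mulVec_mulVec,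
    mulVec_mulVec, Matrix.mul_assoc]

theorem star_dotProduct_transpose_mulVec {k : ℕ} (M : Matrix (Fin k) (Fin k) ℂ)
    (z : Fin k → ℂ) : star z ⬝ᵥ (Mᵀ *ᵥ z) = star (star z) ⬝ᵥ (M *ᵥ star z) := by
  rw [star_star, mulVec_transpose, dotProduct_comm, ← dotProduct_mulVec]

/-- The Hermitian form of `H(w)` is `u ↦ (1 + ‖w‖²) ‖u‖² - |wᵀ u|²`. -/
theorem star_dotProduct_Hmat_mulVec {N : ℕ} (w u : Fin N → ℂ) :
    star u ⬝ᵥ (Hmat w *ᵥ u) = (((1 + sqNorm w) * sqNorm u - ‖w ⬝ᵥ u‖ ^ 2 : ℝ) : ℂ) := by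
  have h : star u ⬝ᵥ star w = star (w ⬝ᵥ u) := by rw [star_dotProduct_star, dotProduct_comm]
  rw [Hmat, sub_mulVec, dotProduct_sub, smul_mulVec, one_mulVec, dotProduct_smul,
    star_dotProduct_self_eq_sqNorm, vecMulVec_mulVec, op_smul_eq_smul, dotProduct_smul, h]
  simp [Complex.mul_conj']

/-- Let `ε > 0`, let `w ∈ ℂ^N`, let `J` be an `n×N` complex matrix, set
`F = J H(w) J^*`, and let `Φ, Ψ` be `n×n` complex matrices satisfying
`‖J‖₂² · ‖Ψ‖₂² < ε`.  Then for every nonzero `x ∈ ℂ^n` one has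
`(1+‖w‖²)⁻² · x^*(Φ F Φ^* − Ψ Fᵀ Ψ^*) x + ε‖x‖² > 0`
(in the complex order). -/
theorem stmt5 {N n : ℕ} (ε : ℝ) (hε : 0 < ε) (w : Fin N → ℂ)
    (J : Matrix (Fin n) (Fin N) ℂ) (Φ Ψ : Matrix (Fin n) (Fin n) ℂ)
    (F : Matrix (Fin n) (Fin n) ℂ) (hF : F = J * Hmat w * Jᴴ)
    (hΨ : opNorm J ^ 2 * opNorm Ψ ^ 2 < ε) :
    ∀ x : Fin n → ℂ, x ≠ 0 →
      (0 : ℂ)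
        < ((((1 + sqNorm w) ^ 2)⁻¹ : ℝ) : ℂ)
              * (star x ⬝ᵥ (Φ * F * Φᴴ - Ψ * Fᵀ * Ψᴴ).mulVec x)
            + ((ε * sqNorm x : ℝ) : ℂ) := by
  intro x hx
  set y := Jᴴ *ᵥ (Φᴴ *ᵥ x)
  set u := Jᴴ *ᵥ star (Ψᴴ *ᵥ x)
  rw [sub_mulVec, dotProduct_sub, star_dotProduct_mul_mul_conjTranspose_mulVec Φ,
    star_dotProduct_mul_mul_conjTranspose_mulVec Ψ, star_dotProduct_transpose_mulVec, hF,
    star_dotProduct_mul_mul_conjTranspose_mulVec J,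
    star_dotProduct_mul_mul_conjTranspose_mulVec J, star_dotProduct_Hmat_mulVec,
    star_dotProduct_Hmat_mulVec]
  norm_cast
  have hw := sqNorm_nonneg w
  have hy := norm_dotProduct_sq_le w y
  have hy0 := sqNorm_nonneg y
  have hu0 := sqNorm_nonneg u
  have hu : sqNorm u ≤ opNorm J ^ 2 * opNorm Ψ ^ 2 * sqNorm x := by
    rw [mul_assoc]
    refine (sqNorm_conjTranspose_mulVec_le J _).trans ?_
    rw [sqNorm_star]
    gcongr
    exact sqNorm_conjTranspose_mulVec_le Ψ x
  have hux : sqNorm u < ε * sqNorm x :=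
    hu.trans_lt (mul_lt_mul_of_pos_right hΨ (sqNorm_pos hx))
  have hform : -((1 + sqNorm w) ^ 2 * sqNorm u) ≤
      (1 + sqNorm w) * sqNorm y - ‖w ⬝ᵥ y‖ ^ 2 -
        ((1 + sqNorm w) * sqNorm u - ‖w ⬝ᵥ u‖ ^ 2) := by
    nlinarith [sq_nonneg ‖w ⬝ᵥ u‖, mul_nonneg hw hu0, mul_nonneg hw (mul_nonneg hw hu0)]
  have hscaled := mul_le_mul_of_nonneg_left hform
    (inv_nonneg.mpr (sq_nonneg (1 + sqNorm w)))
  rw [mul_neg, inv_mul_cancel_left₀ (by positivity)] at hscaled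
  linarith
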